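/- arXiv:2508.14271 — 9 statements merged into one kernel-verified Lean document; each statement's English description precedes it below -/
import Mathlib

section
/- Let M be a monoid and let S, T : M → M be associative functions (spaces) with S∘T = T∘S. Then S∘T is associative (a space). -/
/-- A function `S : M → M` is *associative* (a *space*) if
`S(x*y) = S(S(x)*y)` and `S(x*y) = S(x*S(y))` for all `x, y`. -/
def IsSpace {M : Type*} [Monoid M] (S : M → M) : Prop :=
  (∀ x y : M, S (x * y) = S (S x * y)) ∧ (∀ x y : M, S (x * y) = S (x * S y))

/-- If spaces `S` and `T` commute, then `S ∘ T` is a space. -/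
theorem comp_of_commuting_spaces {M : Type*} [Monoid M] (S T : M → M)
    (hS : IsSpace S) (hT : IsSpace T) (hc : S ∘ T = T ∘ S) :
    IsSpace (S ∘ T) := by
  have h : ∀ a, S (T a) = T (S a) := fun a => congrFun hc a
  refine ⟨fun x y => ?_, fun x y => ?_⟩
  · show S (T (x * y)) = S (T (S (T x) * y))
    rw [h (S (T x) * y), ← hS.1, ← h, ← hT.1]
  · show S (T (x * y)) = S (T (x * S (T y)))
    rw [h (x * S (T y)), ← hS.2, ← h, ← hT.2]
end

section
/- Let M be a monoid, S : M → M an associative function (a space), and f, g endomorphisms of S (i.e. f = S∘f∘S and g = S∘g∘S). Then the sum f ⊕_S g, defined by (f ⊕_S g)(x) = S(f(x)*g(x)), is again an endomorphism of S, i.e. f ⊕_S g = S∘(f ⊕_S g)∘S. -/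
/-- The sum `f ⊕_S g` of endomorphisms relative to the space `S`. -/
def oplus {M : Type*} [Monoid M] (S f g : M → M) : M → M :=
  fun x => S (f x * g x)

/-- The sum of two endomorphisms of a space `S` is again an endomorphism of `S`. -/
theorem oplus_is_endomorphism {M : Type*} [Monoid M] (S : M → M) (hS : IsSpace S)
    (f g : M → M) (hf : f = S ∘ f ∘ S) (hg : g = S ∘ g ∘ S) :
    oplus S f g = S ∘ (oplus S f g) ∘ S := by
  have idem : ∀ x, S (S x) = S x := fun x => by
    have h := hS.1 x 1
    simp only [mul_one] at h
    exact h.symm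
  have key : ∀ h : M → M, h = S ∘ h ∘ S → ∀ x, h (S x) = h x := by
    intro h hh x
    have h1 : h (S x) = S (h (S (S x))) := congrFun hh (S x)
    have h2 : h x = S (h (S x)) := congrFun hh x
    rw [h1, idem, ← h2]
  funext x
  simp only [oplus, Function.comp_apply]
  rw [idem, key f hf, key g hg]
end

section
/- Let M be a monoid, S : M → M an associative function (a space), and let f, g, h be endomorphisms of S (each equal to S∘·∘S). Define 0_S : M → M by 0_S(x) = S(1). Then: (a) (f ⊕_S g) ⊕_S h = f ⊕_S (g ⊕_S h); (b) f ⊕_S 0_S = f and 0_S ⊕_S f = f; (c) S∘f = f and f∘S = f (so S is a two-sided identity for composition of endomorphisms); (d) (f ⊕_S g)∘h = (f∘h) ⊕_S (g∘h). Hence the endomorphisms of S form a semiring-like structure (associative addition with zero, associative composition with unit S, right distributivity). -/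
/-- The zero endomorphism `0_S` of a space `S`. -/
def zeroS {M : Type*} [Monoid M] (S : M → M) : M → M :=
  fun _ => S 1

/-- The endomorphisms of a space `S` form a semiring-like structure:
addition `⊕_S` is associative with zero `0_S`, composition has unit `S`,
and composition distributes over addition from the right. -/
theorem endomorphisms_form_semiring {M : Type*} [Monoid M] (S : M → M) (hS : IsSpace S)
    (f g h : M → M) (hf : f = S ∘ f ∘ S) (hg : g = S ∘ g ∘ S) (hh : h = S ∘ h ∘ S) :
    oplus S (oplus S f g) h = oplus S f (oplus S g h) ∧
    oplus S f (zeroS S) = f ∧ oplus S (zeroS S) f = f ∧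
    S ∘ f = f ∧ f ∘ S = f ∧
    (oplus S f g) ∘ h = oplus S (f ∘ h) (g ∘ h) := by
  obtain ⟨h1, h2⟩ := hS
  have idem : ∀ x, S (S x) = S x := fun x => by
    have := h1 x 1
    simpa using this.symm
  have a : ∀ x, S (f x) = f x := fun x => by
    rw [congrFun hf x]
    exact idem _
  have b : ∀ x, f (S x) = f x := fun x => by
    rw [congrFun hf (S x), congrFun hf x]
    simp only [Function.comp_apply, idem]
  refine ⟨?_, ?_, ?_, funext a, funext b, rfl⟩
  · funext x
    simp only [oplus]
    rw [← h1, ← h2, mul_assoc]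
  · funext x
    simp only [oplus, zeroS]
    rw [← h2, mul_one, a]
  · funext x
    simp only [oplus, zeroS]
    rw [← h1, one_mul, a]
end

section
/- Let M be a monoid, S, T : M → M associative functions (spaces), and H : M → M with H = T∘H∘S. Then the following are equivalent: (i) H∘(f ⊕_S g) = (H∘f) ⊕_T (H∘g) for all endomorphisms f, g of S; (ii) H(S(x*y)) = T(H(x)*H(y)) for all x, y in M. (This gives a pointwise characterization of homomorphisms between spaces.) -/
/-- Pointwise characterization of homomorphisms between spaces: a morphism
`H = T∘H∘S` distributes over sums of endomorphisms iff
`H(S(x*y)) = T(H(x)*H(y))` for all `x, y`. -/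
theorem homomorphism_pointwise_characterization {M : Type*} [Monoid M]
    (S T H : M → M) (hS : IsSpace S) (hT : IsSpace T) (hH : H = T ∘ H ∘ S) :
    (∀ f g : M → M, f = S ∘ f ∘ S → g = S ∘ g ∘ S →
        H ∘ (oplus S f g) = oplus T (H ∘ f) (H ∘ g)) ↔
      (∀ x y : M, H (S (x * y)) = T (H x * H y)) := by
  have idem : ∀ x, S (S x) = S x := fun x => by
    have h := hS.1 x 1
    simpa using h.symm
  have hHS : ∀ x, H (S x) = H x := fun x => by
    have h1 := congrFun hH (S x)
    have h2 := congrFun hH x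
    simp only [Function.comp] at h1 h2
    rw [idem] at h1
    exact h1.trans h2.symm
  constructor
  · intro h x y
    have h0 := h (fun _ => S x) (fun _ => S y)
      (by funext z; simp [idem]) (by funext z; simp [idem])
    have h1 := congrFun h0 1
    change H (S (S x * S y)) = T (H (S x) * H (S y)) at h1
    rw [← hS.2, ← hS.1, hHS x, hHS y] at h1
    exact h1
  · intro h f g _ _
    funext x
    exact h (f x) (g x)
end

section
/- Let M be a monoid, S, T : M → M associative functions (spaces), and U a homomorphism from S to T which is idempotent (U∘U = U). Then U is itself associative (a space): U(x*y) = U(U(x)*y) and U(x*y) = U(x*U(y)) for all x, y in M. -/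
/-- A *homomorphism* from space `S` to space `T`. -/
def IsHom {M : Type*} [Monoid M] (S T H : M → M) : Prop :=
  H = T ∘ H ∘ S ∧ ∀ x y : M, H (S (x * y)) = T (H x * H y)

/-- Any idempotent homomorphism between spaces is itself a space. -/
theorem idempotent_hom_is_space {M : Type*} [Monoid M] (S T U : M → M)
    (hS : IsSpace S) (hT : IsSpace T) (hU : IsHom S T U) (hidem : U ∘ U = U) :
    IsSpace U := by
  have hSS : ∀ x, S (S x) = S x := fun x => by
    have h := hS.1 x 1
    simp only [mul_one] at h
    exact h.symm
  have hUS : ∀ x, U (S x) = U x := fun x => by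
    have h1 := congrFun hU.1 (S x)
    have h2 := congrFun hU.1 x
    simp only [Function.comp_apply, hSS] at h1 h2
    rw [h1, ← h2]
  have hUU : ∀ x, U (U x) = U x := fun x => congrFun hidem x
  have key : ∀ x y, U (x * y) = T (U x * U y) := fun x y => by
    rw [← hU.2, hUS]
  exact ⟨fun x y => by rw [key, key, hUU], fun x y => by rw [key, key, hUU]⟩
end

section
/- Let M be a monoid, S : M → M an associative function (a space), and s : M → M a subspace of S, i.e. s is associative and s = S∘s∘S. Then subspaces partially distribute from the left: for all functions f, g : M → M, s∘(f ⊕_S g) = s∘((s∘f) ⊕_S (s∘g)). -/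
/-- Subspaces partially distribute from the left:
`s∘(f ⊕_S g) = s∘((s∘f) ⊕_S (s∘g))`. -/
theorem subspace_left_distributes {M : Type*} [Monoid M] (S s : M → M)
    (hS : IsSpace S) (hs : IsSpace s) (hsub : s = S ∘ s ∘ S) :
    ∀ f g : M → M, s ∘ (oplus S f g) = s ∘ (oplus S (s ∘ f) (s ∘ g)) := by
  intro f g
  have hid : ∀ x, S (S x) = S x := fun x => by
    have h := hS.1 x 1
    simpa using h.symm
  have hsS : ∀ x, s (S x) = s x := fun x => by
    have h1 := congrFun hsub (S x)
    have h2 := congrFun hsub x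
    simp only [Function.comp_apply, hid] at h1 h2
    exact h1.trans h2.symm
  funext x
  simp only [Function.comp_apply, oplus, hsS]
  exact (hs.1 _ _).trans (hs.2 _ _)
end

section
/- Let M be a monoid, S, T : M → M associative functions (spaces), and h a homomorphism from S to T. Suppose h factors as h = m∘e where m : M → M is injective, e is an idempotent endomorphism of S (e = S∘e∘S and e∘e = e), and h∘e = h. Then e satisfies the quotient identity: for all functions f, g : M → M, e∘(f ⊕_S g) = e∘((e∘f) ⊕_S (e∘g)). (Hence the quotient e = S/h is a subspace of S.) -/
/-- If a homomorphism `h : S → T` factors as `h = m∘e` with `m` injective and `e` an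
idempotent endomorphism of `S` satisfying `h∘e = h`, then the quotient `e = S/h`
satisfies the subspace identity `e∘(f ⊕_S g) = e∘((e∘f) ⊕_S (e∘g))`. -/
theorem quotient_is_subspace {M : Type*} [Monoid M] (S T h m e : M → M)
    (hS : IsSpace S) (hT : IsSpace T) (hh : IsHom S T h)
    (hfac : h = m ∘ e) (hm : Function.Injective m)
    (he_endo : e = S ∘ e ∘ S) (he_idem : e ∘ e = e) (hhe : h ∘ e = h) :
    ∀ f g : M → M, e ∘ (oplus S f g) = e ∘ (oplus S (e ∘ f) (e ∘ g)) := by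
  intro f g
  funext x
  apply hm
  have h1 : ∀ y, m (e y) = h y := fun y => (congrFun hfac y).symm
  have h2 : ∀ y, h (e y) = h y := fun y => congrFun hhe y
  simp only [Function.comp_apply, oplus, h1, hh.2, h2]
end

section
/- Let t, p be natural numbers with p ≥ 1, and define f : ℕ → ℕ by f(n) = n if n < t, and f(n) = t + ((n − t) mod p) if n ≥ t. Then f∘f = f and, for all m, n ∈ ℕ, f(m + n) = f(f(m) + n) and f(m + n) = f(m + f(n)). (These are the subspaces of the organic natural numbers: the case t = 0 gives addition modulo p, and the case p = 1 gives the saturation map n ↦ min(n, t).) -/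
/-- The subspaces `rem(p, t+1)` of the organic natural numbers: the map
`f(n) = n` for `n < t` and `f(n) = t + ((n - t) mod p)` for `n ≥ t` is an associative
idempotent of the additive monoid ℕ. -/
theorem rem_is_subspace_of_naturals (t p : ℕ) (hp : 1 ≤ p) (f : ℕ → ℕ)
    (hf : ∀ n : ℕ, f n = if n < t then n else t + (n - t) % p) :
    f ∘ f = f ∧ (∀ m n : ℕ, f (m + n) = f (f m + n)) ∧
      (∀ m n : ℕ, f (m + n) = f (m + f n)) := by
  have h1 : ∀ m n : ℕ, f (m + n) = f (f m + n) := by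
    intro m n
    by_cases hm : m < t
    · rw [hf m, if_pos hm]
    · rw [hf m, if_neg hm, hf (m + n), hf (t + (m - t) % p + n),
        if_neg (by omega), if_neg (by omega)]
      have e1 : m + n - t = (m - t) + n := by omega
      have e2 : t + (m - t) % p + n - t = (m - t) % p + n := by omega
      rw [e1, e2, Nat.mod_add_mod]
  refine ⟨?_, h1, ?_⟩
  · funext m
    have h := h1 m 0
    simpa using h.symm
  · intro m n
    rw [add_comm m n, add_comm m (f n)]
    exact h1 n m
end

section
/- Let α be a type with decidable equality and let F : Finset α → Finset α be a bijection satisfying F(s ∪ t) = F(s) ∪ F(t) for all finite sets s, t. Then there exists a permutation σ of α such that F(s) = image of s under σ for every finite set s. (The group of units of the semilattice space of finite subsets is exactly the group of permutations of the underlying atoms.) -/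
/-- The units of the semilattice space of finite subsets are exactly permutations:
any bijection of `Finset α` preserving unions is given by the image map of a
permutation of `α`. -/
theorem union_preserving_bijection_is_permutation {α : Type*} [DecidableEq α]
    (F : Finset α → Finset α) (hbij : Function.Bijective F)
    (hU : ∀ s t : Finset α, F (s ∪ t) = F s ∪ F t) :
    ∃ σ : Equiv.Perm α, ∀ s : Finset α, F s = s.image σ := by
  have hle : ∀ s t, F s ≤ F t ↔ s ≤ t := by
    intro s t
    have h1 : F s ≤ F t ↔ F s ∪ F t = F t := Finset.union_eq_right.symm
    have h2 : s ≤ t ↔ s ∪ t = t := Finset.union_eq_right.symm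
    rw [h1, h2, ← hU, hbij.1.eq_iff]
  let e : Finset α ≃o Finset α :=
    { toEquiv := Equiv.ofBijective F hbij, map_rel_iff' := fun {s t} => hle s t }
  have he : ∀ s, e s = F s := fun s => rfl
  have hat : ∀ s, IsAtom (F s) ↔ IsAtom s := fun s => e.isAtom_iff s
  have hs : ∀ a, ∃ b, F {a} = {b} := fun a =>
    Finset.isAtom_iff.1 ((hat _).2 (Finset.isAtom_singleton a))
  choose f hf using hs
  have hfb : Function.Bijective f := by
    constructor
    · intro a b hab
      have h : F {a} = F {b} := by rw [hf, hf, hab]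
      exact Finset.singleton_injective (hbij.1 h)
    · intro b
      obtain ⟨s, hs⟩ := hbij.2 {b}
      have h : IsAtom s := (hat s).1 (hs ▸ Finset.isAtom_singleton b)
      obtain ⟨a, rfl⟩ := Finset.isAtom_iff.1 h
      exact ⟨a, Finset.singleton_injective ((hf a).symm.trans hs)⟩
  have h0 : F ∅ = ∅ := e.map_bot
  refine ⟨Equiv.ofBijective f hfb, fun s => ?_⟩
  induction s using Finset.induction_on with
  | empty => simpa using h0
  | insert a s _ ih =>
    rw [Finset.insert_eq, hU, ih, hf, Finset.image_union, Finset.image_singleton]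
    rfl
end
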